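/- Let T = {1,…,6}, and for a PMP M on T and χ ∈ {0,1}^6 define b_{M,χ} := Π_{(st,σ) ∈ M} [χ, 𝟙−χ]_{st,σ}. Consider the six PMPs M₁ := {(12,o),(34,o),(56,e)}, M₂ := {(12,o),(36,o),(45,e)}, M₃ := {(14,o),(23,o),(56,e)}, M₄ := {(14,o),(36,o),(25,e)}, M₅ := {(16,o),(23,e),(45,o)}, M₆ := {(16,o),(34,e),(25,o)} (o = odd, e = even). Then for every χ ∈ {0,1}^6: b_{M₁,χ} = b_{M₂,χ} + b_{M₃,χ} − b_{M₄,χ} + b_{M₅,χ} − b_{M₆,χ}. -/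

import Mathlib

/-- A parity: `odd` or `even`. -/
inductive Par : Type
  | odd : Par
  | even : Par
deriving DecidableEq

/-- The bracket `[p,q]_{st,σ}`: for a parity `σ` and an unordered pair `{s,t}`,
`[p,q]_{st,odd} = p_s p_t + q_s q_t` and `[p,q]_{st,even} = p_s q_t + q_s p_t`. -/
def brkt {n : ℕ} (p q : Fin n → ℤ) (σ : Par) : Sym2 (Fin n) → ℤ :=
  Sym2.lift ⟨fun s t =>
    match σ with
    | Par.odd => p s * p t + q s * q t
    | Par.even => p s * q t + q s * p t,
    by intro a b; cases σ <;> dsimp only <;> ring⟩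

/-- A perfect matching with parity (PMP) on `{0, …, n−1}`: a set of pairs
`(st, σ)` where the unordered pairs `st` are non-degenerate and partition the
index set, and `σ` is a parity. -/
def IsPMP {n : ℕ} (M : Finset (Sym2 (Fin n) × Par)) : Prop :=
  (∀ x ∈ M, ¬ x.1.IsDiag) ∧ ∀ i : Fin n, ∃! x, x ∈ M ∧ i ∈ x.1

/-- The product `Π_{(st,σ) ∈ M} [p,q]_{st,σ}`. -/
def pmpProd {n : ℕ} (p q : Fin n → ℤ) (M : Finset (Sym2 (Fin n) × Par)) : ℤ :=
  ∏ x ∈ M, brkt p q x.2 x.1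

/-- The `{0,1}`-valued indicator of a Boolean, as an integer. -/
def ind : Bool → ℤ := fun b => if b then 1 else 0

/-- `b_{M,χ} := Π_{(st,σ) ∈ M} [χ, 𝟙−χ]_{st,σ}`, for `χ ∈ {0,1}^{2τ}` encoded as a
function into `Bool`. -/
def bval {n : ℕ} (M : Finset (Sym2 (Fin n) × Par)) (χ : Fin n → Bool) : ℤ :=
  pmpProd (fun i => ind (χ i)) (fun i => 1 - ind (χ i)) M

/-- `bval` of a set of three distinct pairs is the product of the three brackets. -/
theorem bval_triple {n : ℕ} (χ : Fin n → Bool) {x y z : Sym2 (Fin n) × Par}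
    (hxy : x ≠ y) (hxz : x ≠ z) (hyz : y ≠ z) :
    bval {x, y, z} χ =
      brkt (fun i => ind (χ i)) (fun i => 1 - ind (χ i)) x.2 x.1 *
      (brkt (fun i => ind (χ i)) (fun i => 1 - ind (χ i)) y.2 y.1 *
      brkt (fun i => ind (χ i)) (fun i => 1 - ind (χ i)) z.2 z.1) := by
  rw [bval, pmpProd, Finset.prod_insert (by simp [hxy, hxz]), Finset.prod_pair hyz]


/-- For `T = {1,…,6}` (encoded as `Fin 6`) and the six PMPs
`M₁ = {(12,o),(34,o),(56,e)}`, `M₂ = {(12,o),(36,o),(45,e)}`,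
`M₃ = {(14,o),(23,o),(56,e)}`, `M₄ = {(14,o),(36,o),(25,e)}`,
`M₅ = {(16,o),(23,e),(45,o)}`, `M₆ = {(16,o),(34,e),(25,o)}`:
for every `χ ∈ {0,1}^6`,
`b_{M₁,χ} = b_{M₂,χ} + b_{M₃,χ} − b_{M₄,χ} + b_{M₅,χ} − b_{M₆,χ}`. -/
theorem bval_relation (χ : Fin 6 → Bool) :
    bval ({(s(0, 1), Par.odd), (s(2, 3), Par.odd), (s(4, 5), Par.even)} :
        Finset (Sym2 (Fin 6) × Par)) χ =
      bval {(s(0, 1), Par.odd), (s(2, 5), Par.odd), (s(3, 4), Par.even)} χ +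
      bval {(s(0, 3), Par.odd), (s(1, 2), Par.odd), (s(4, 5), Par.even)} χ -
      bval {(s(0, 3), Par.odd), (s(2, 5), Par.odd), (s(1, 4), Par.even)} χ +
      bval {(s(0, 5), Par.odd), (s(1, 2), Par.even), (s(3, 4), Par.odd)} χ -
      bval {(s(0, 5), Par.odd), (s(2, 3), Par.even), (s(1, 4), Par.odd)} χ := by
  rw [bval_triple χ (by decide) (by decide) (by decide),
    bval_triple χ (by decide) (by decide) (by decide),
    bval_triple χ (by decide) (by decide) (by decide),
    bval_triple χ (by decide) (by decide) (by decide),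
    bval_triple χ (by decide) (by decide) (by decide),
    bval_triple χ (by decide) (by decide) (by decide)]
  simp only [brkt, Sym2.lift_mk]
  generalize χ 0 = a, χ 1 = b, χ 2 = c, χ 3 = d, χ 4 = e, χ 5 = f
  revert a b c d e f
  decide
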